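/- Let 𝒜₁ and 𝒜₂ be central arrangements in ℂ³ with isomorphic intersection lattices but different multisets of exponents exp(𝒜₁) ≠ exp(𝒜₂) (i.e., a Ziegler pair). Let 𝓑ᵢ = 𝒜ᵢ ∪ {Hᵢ} where Hᵢ is a hyperplane combinatorially generic with respect to 𝒜ᵢ. Then exp(𝓑₁) ≠ exp(𝓑₂); in particular 𝓑₁ and 𝓑₂ form a Ziegler pair. -/

import Mathlib

open MvPolynomial

noncomputable section

/-- The polynomial ring `S = ℂ[x₁,…,x_ℓ]`. -/
abbrev PS (ℓ : ℕ) : Type := MvPolynomial (Fin ℓ) ℂ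

/-- The module of ℂ-derivations of `S`. -/
abbrev Der (ℓ : ℕ) : Type := Derivation ℂ (PS ℓ) (PS ℓ)

/-- The logarithmic derivation module of a set of defining forms in a ℂ-algebra. -/
def logDer {R : Type} [CommRing R] [Algebra ℂ R] (A : Set R) :
    Submodule R (Derivation ℂ R R) where
  carrier := {θ | ∀ α ∈ A, θ α ∈ Ideal.span {α}}
  add_mem' := fun ha hb α hα => by simpa using add_mem (ha α hα) (hb α hα)
  zero_mem' := fun α hα => by simp
  smul_mem' := fun c θ h α hα => by simpa using Ideal.mul_mem_left _ c (h α hα)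

/-- The submodule `D₀` of derivations annihilating every defining form. -/
def logDer0 {R : Type} [CommRing R] [Algebra ℂ R] (A : Set R) :
    Submodule R (Derivation ℂ R R) where
  carrier := {θ | ∀ α ∈ A, θ α = 0}
  add_mem' := fun ha hb α hα => by simp [Set.mem_setOf_eq] at *; simp [ha α hα, hb α hα]
  zero_mem' := fun α hα => by simp
  smul_mem' := fun c θ h α hα => by simp [Set.mem_setOf_eq] at *; simp [h α hα]

/-- The Euler derivation `Σ xᵢ ∂ᵢ`. -/
def euler (ℓ : ℕ) : Der ℓ := mkDerivation ℂ (fun i : Fin ℓ => X i)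

/-- A derivation is homogeneous of (polynomial) degree `d` if it sends every variable to a
homogeneous polynomial of degree `d`. -/
def IsHomogDer {ℓ : ℕ} (θ : Der ℓ) (d : ℕ) : Prop := ∀ i, (θ (X i)).IsHomogeneous d

/-- A (nonzero) linear form. -/
def IsLinForm {ℓ : ℕ} (α : PS ℓ) : Prop := α.IsHomogeneous 1 ∧ α ≠ 0

/-- A minimal generating family of the logarithmic derivation module of `A`. -/
def IsMinGen {R : Type} [CommRing R] [Algebra ℂ R] (A : Set R) {s : ℕ}
    (θ : Fin s → Derivation ℂ R R) : Prop :=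
  Submodule.span R (Set.range θ) = logDer A ∧
    ∀ i, θ i ∉ Submodule.span R (θ '' {j | j ≠ i})

/-- A minimal generating family of `D₀(A)`. -/
def IsMinGen0 {R : Type} [CommRing R] [Algebra ℂ R] (A : Set R) {s : ℕ}
    (θ : Fin s → Derivation ℂ R R) : Prop :=
  Submodule.span R (Set.range θ) = logDer0 A ∧
    ∀ i, θ i ∉ Submodule.span R (θ '' {j | j ≠ i})

/-- `exp(A) = M`:  the multiset of degrees of a minimal homogeneous generating family
of `D(A)` is `M`. -/
def HasExp {ℓ : ℕ} (A : Set (PS ℓ)) (M : Multiset ℕ) : Prop :=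
  ∃ (s : ℕ) (θ : Fin s → Der ℓ) (d : Fin s → ℕ),
    (∀ i, IsHomogDer (θ i) (d i)) ∧ IsMinGen A θ ∧ M = Multiset.map d Finset.univ.val

/-- `exp₀(A) = M`: the multiset of degrees of a minimal homogeneous generating family
of `D₀(A)` is `M`. -/
def HasExp0 {ℓ : ℕ} (A : Set (PS ℓ)) (M : Multiset ℕ) : Prop :=
  ∃ (s : ℕ) (θ : Fin s → Der ℓ) (d : Fin s → ℕ),
    (∀ i, IsHomogDer (θ i) (d i)) ∧ IsMinGen0 A θ ∧ M = Multiset.map d Finset.univ.val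

/-- The rank of a finite set of linear forms (= codimension of the corresponding flat). -/
def rk {ℓ : ℕ} (B : Finset (PS ℓ)) : ℕ :=
  Module.finrank ℂ (Submodule.span ℂ (B : Set (PS ℓ)))

/-- `H = {α = 0}` is combinatorially generic with respect to the arrangement `A` in `ℂ^m`:
it contains no nonzero flat of `A`, i.e. adding it to any subarrangement raises the rank
until the ambient rank `m` is reached. -/
def CombGeneric {ℓ : ℕ} (α : PS ℓ) (A : Finset (PS ℓ)) (m : ℕ) : Prop :=
  ∀ B ⊆ A, rk (insert α B) = min (rk B + 1) m

/-- Two arrangements have the same combinatorics (isomorphic intersection lattices):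
there is a bijection of the hyperplanes preserving the rank of every subarrangement. -/
def SameComb {ℓ ℓ' : ℕ} (A₁ : Finset (PS ℓ)) (A₂ : Finset (PS ℓ')) : Prop :=
  ∃ e : PS ℓ → PS ℓ', Set.BijOn e A₁ A₂ ∧
    ∀ B ⊆ A₁, rk (B.image e) = rk B

/-- The number of hyperplanes of the restriction of `A` to `{α = 0}`: the number of
proportionality classes of the (nonzero) images of the forms of `A` in `S/(α)`. -/
def nRes {ℓ : ℕ} (α : PS ℓ) (A : Finset (PS ℓ)) : ℕ :=
  letI : DecidableEq (Submodule ℂ (PS ℓ ⧸ Ideal.span {α})) := Classical.decEq _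
  (A.image fun β =>
    Submodule.span ℂ {Ideal.Quotient.mk (Ideal.span {α}) β}).card

end

noncomputable section

theorem homogeneousComponent_mul_of_isHomogeneous {ℓ : ℕ} {β : PS ℓ} {d : ℕ}
    (hβ : β.IsHomogeneous d) (k : ℕ) (f : PS ℓ) :
    homogeneousComponent k (f * β) =
      if d ≤ k then homogeneousComponent (k - d) f * β else 0 := by
  conv_lhs => rw [← sum_homogeneousComponent f, Finset.sum_mul, map_sum]
  have key : ∀ i, homogeneousComponent k (homogeneousComponent i f * β) =
      if k = i + d then homogeneousComponent i f * β else 0 := fun i =>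
    homogeneousComponent_of_mem ((homogeneousComponent_isHomogeneous i f).mul hβ)
  simp only [key]
  split_ifs with hk
  · rw [Finset.sum_eq_single (k - d) (fun i _ hi => if_neg (by omega)) fun hi => ?_,
      if_pos (by omega)]
    rw [homogeneousComponent_eq_zero _ _ (by have := Finset.mem_range.not.1 hi; omega),
      zero_mul, ite_self]
  · exact Finset.sum_eq_zero fun i _ => if_neg (by omega)

/-- The homogeneous component of degree `k` of a derivation. -/
def homogComp {ℓ : ℕ} (k : ℕ) : Der ℓ →ₗ[ℂ] Der ℓ where
  toFun θ := mkDerivation ℂ fun i => homogeneousComponent k (θ (X i))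
  map_add' θ ψ := derivation_ext fun i => by simp [mkDerivation_X]
  map_smul' c θ := derivation_ext fun i => by simp [mkDerivation_X]

@[simp]
theorem homogComp_X {ℓ : ℕ} (k : ℕ) (θ : Der ℓ) (i : Fin ℓ) :
    homogComp k θ (X i) = homogeneousComponent k (θ (X i)) :=
  mkDerivation_X ..

theorem isHomogDer_homogComp {ℓ : ℕ} (k : ℕ) (θ : Der ℓ) : IsHomogDer (homogComp k θ) k :=
  fun i => by simpa using homogeneousComponent_isHomogeneous k _

theorem homogComp_of_isHomogDer {ℓ : ℕ} {θ : Der ℓ} {k : ℕ} (h : IsHomogDer θ k) :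
    homogComp k θ = θ :=
  derivation_ext fun i => by simpa using homogeneousComponent_eq_self (h i)

theorem homogComp_smul {ℓ : ℕ} {θ : Der ℓ} {d : ℕ} (h : IsHomogDer θ d) (k : ℕ) (f : PS ℓ) :
    homogComp k (f • θ) = if d ≤ k then homogeneousComponent (k - d) f • θ else 0 :=
  derivation_ext fun i => by
    have := homogeneousComponent_mul_of_isHomogeneous (h i) k f
    split_ifs at this ⊢ <;> simpa using this

theorem homogComp_sum_smul {ℓ : ℕ} {ι : Type*} [Fintype ι] {θ : ι → Der ℓ} {d : ι → ℕ}
    (h : ∀ i, IsHomogDer (θ i) (d i)) (k : ℕ) (f : ι → PS ℓ) :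
    homogComp k (∑ i, f i • θ i) =
      ∑ i, if d i ≤ k then homogeneousComponent (k - d i) (f i) • θ i else 0 := by
  rw [map_sum]
  exact Finset.sum_congr rfl fun i _ => homogComp_smul (h i) k (f i)

theorem exists_sum_homogComp {ℓ : ℕ} (θ : Der ℓ) :
    ∃ n, ∑ k ∈ Finset.range n, homogComp k θ = θ := by
  refine ⟨(Finset.univ.sup fun i => (θ (X i)).totalDegree) + 1, derivation_ext fun i => ?_⟩
  rw [← Derivation.coeFnAddMonoidHom_apply, map_sum, Finset.sum_apply]
  simp only [Derivation.coeFnAddMonoidHom_apply, homogComp_X]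
  conv_rhs => rw [← sum_homogeneousComponent (θ (X i))]
  symm
  refine Finset.sum_subset ?_ fun k _ hk => ?_
  · exact Finset.range_mono
      (Nat.succ_le_succ (Finset.le_sup (f := fun i => (θ (X i)).totalDegree) (Finset.mem_univ i)))
  · apply homogeneousComponent_eq_zero
    simpa [Nat.lt_succ_iff, Nat.succ_le_iff] using hk

theorem IsHomogDer.smul {ℓ : ℕ} {θ : Der ℓ} {d e : ℕ} {f : PS ℓ} (hf : f.IsHomogeneous e)
    (h : IsHomogDer θ d) : IsHomogDer (f • θ) (e + d) :=
  fun i => by simpa using hf.mul (h i)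

/-- A homogeneous element of a graded submodule is, up to generators of smaller degree, a
ℂ-linear combination of the generators of its own degree. -/
theorem exists_sub_sum_mem_span {ℓ : ℕ} {ι : Type*} [Fintype ι] {θ : ι → Der ℓ} {d : ι → ℕ}
    (h : ∀ i, IsHomogDer (θ i) (d i)) {x : Der ℓ} {k : ℕ} (hx : IsHomogDer x k)
    (hmem : x ∈ Submodule.span (PS ℓ) (Set.range θ)) :
    ∃ c : ι → ℂ, x - ∑ i with d i = k, c i • θ i ∈
      Submodule.span (PS ℓ) (θ '' {i | d i < k}) := by
  obtain ⟨f, rfl⟩ := (Submodule.mem_span_range_iff_exists_fun _).1 hmem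
  refine ⟨fun i => coeff 0 (f i), ?_⟩
  rw [← homogComp_of_isHomogDer hx, homogComp_sum_smul h, Finset.sum_filter,
    ← Finset.sum_sub_distrib]
  refine Submodule.sum_mem _ fun i _ => ?_
  rcases lt_trichotomy (d i) k with hi | hi | hi
  · rw [if_pos hi.le, if_neg hi.ne, sub_zero]
    exact Submodule.smul_mem _ _ (Submodule.subset_span ⟨i, hi, rfl⟩)
  · rw [if_pos hi.le, if_pos hi, hi, Nat.sub_self, homogeneousComponent_zero,
      ← algebraMap_eq, algebraMap_smul, sub_self]
    exact zero_mem _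
  · rw [if_neg hi.not_ge, if_neg hi.ne', sub_zero]
    exact zero_mem _

/-- The degree `k` part of a submodule of derivations. -/
def gradedPiece {ℓ : ℕ} (N : Submodule (PS ℓ) (Der ℓ)) (k : ℕ) : Submodule ℂ (Der ℓ) where
  carrier := {x | x ∈ N ∧ IsHomogDer x k}
  add_mem' ha hb := ⟨add_mem ha.1 hb.1, fun i => by simpa using (ha.2 i).add (hb.2 i)⟩
  zero_mem' := ⟨zero_mem _, fun i => by simpa using isHomogeneous_zero _ _ k⟩
  smul_mem' c x hx := ⟨by
    rw [← algebraMap_smul (PS ℓ) c x]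
    exact N.smul_mem _ hx.1, fun i => by simpa [smul_eq_C_mul] using (hx.2 i).C_mul c⟩

/-- The submodule generated by the homogeneous elements of degree smaller than `k`. -/
def lowerSpan {ℓ : ℕ} (N : Submodule (PS ℓ) (Der ℓ)) (k : ℕ) : Submodule (PS ℓ) (Der ℓ) :=
  Submodule.span _ {x | ∃ j < k, x ∈ gradedPiece N j}

/-- The number of generators of degree `k` needed by a graded submodule. -/
def genDim {ℓ : ℕ} (N : Submodule (PS ℓ) (Der ℓ)) (k : ℕ) : ℕ :=
  Module.finrank ℂ ((gradedPiece N k).map ((lowerSpan N k).restrictScalars ℂ).mkQ)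

theorem card_degree_eq_genDim {ℓ : ℕ} {ι : Type*} [Fintype ι] {θ : ι → Der ℓ} {d : ι → ℕ}
    (h : ∀ i, IsHomogDer (θ i) (d i))
    (hmin : ∀ i, θ i ∉ Submodule.span (PS ℓ) (θ '' {j | j ≠ i})) (k : ℕ) :
    (Finset.univ.filter fun i => d i = k).card =
      genDim (Submodule.span (PS ℓ) (Set.range θ)) k := by
  classical
  set N := Submodule.span (PS ℓ) (Set.range θ) with hN
  have hθ : ∀ i, θ i ∈ N := fun i => Submodule.subset_span ⟨i, rfl⟩
  have hlow : lowerSpan N k = Submodule.span (PS ℓ) (θ '' {i | d i < k}) := by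
    apply le_antisymm
    · refine Submodule.span_le.2 ?_
      rintro x ⟨j, hj, hxN, hx⟩
      obtain ⟨c, hc⟩ := exists_sub_sum_mem_span h hx hxN
      rw [← sub_add_cancel x (∑ i with d i = j, c i • θ i)]
      refine add_mem (Submodule.span_mono (Set.image_mono fun i hi => lt_trans hi hj) hc) ?_
      refine Submodule.sum_mem _ fun i hi => ?_
      rw [← algebraMap_smul (PS ℓ) (c i) (θ i)]
      refine Submodule.smul_mem _ _ (Submodule.subset_span ⟨i, ?_, rfl⟩)
      rw [Finset.mem_filter] at hi
      exact hi.2.trans_lt hj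
    · refine Submodule.span_mono ?_
      rintro _ ⟨i, hi, rfl⟩
      exact ⟨d i, hi, hθ i, h i⟩
  set π := ((lowerSpan N k).restrictScalars ℂ).mkQ with hπ
  let v : {i // d i = k} → Der ℓ ⧸ (lowerSpan N k).restrictScalars ℂ := fun i => π (θ i)
  have hspan : Submodule.span ℂ (Set.range v) = (gradedPiece N k).map π := by
    apply le_antisymm
    · refine Submodule.span_le.2 ?_
      rintro _ ⟨⟨i, rfl⟩, rfl⟩
      exact ⟨θ i, ⟨hθ i, h i⟩, rfl⟩
    · rintro _ ⟨x, ⟨hxN, hx⟩, rfl⟩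
      obtain ⟨c, hc⟩ := exists_sub_sum_mem_span h hx hxN
      rw [← hlow] at hc
      have : π x = π (∑ i with d i = k, c i • θ i) := by
        rw [← sub_eq_zero, ← map_sub]
        exact (Submodule.Quotient.mk_eq_zero _).2 hc
      rw [this, map_sum]
      refine Submodule.sum_mem _ fun i hi => ?_
      rw [map_smul]
      exact Submodule.smul_mem _ _ (Submodule.subset_span ⟨⟨i, (Finset.mem_filter.1 hi).2⟩, rfl⟩)
  have hli : LinearIndependent ℂ v := by
    rw [Fintype.linearIndependent_iff]
    intro g hg i
    by_contra hgi
    have hmem : ∑ j, g j • θ j ∈ lowerSpan N k := by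
      have : π (∑ j, g j • θ j) = 0 := by
        rw [map_sum, ← hg]
        exact Finset.sum_congr rfl fun j _ => map_smul _ _ _
      exact (Submodule.Quotient.mk_eq_zero _).1 this
    rw [hlow, ← Finset.add_sum_erase _ _ (Finset.mem_univ i)] at hmem
    have hsub : Submodule.span (PS ℓ) (θ '' {j | d j < k}) ≤
        Submodule.span (PS ℓ) (θ '' {j | j ≠ i}) := by
      refine Submodule.span_mono (Set.image_mono ?_)
      rintro j hj rfl
      exact hj.ne i.2
    have hrest : ∑ j ∈ Finset.univ.erase i, g j • θ j ∈
        Submodule.span (PS ℓ) (θ '' {j | j ≠ i}) := by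
      refine Submodule.sum_mem _ fun j hj => ?_
      rw [← algebraMap_smul (PS ℓ) (g j) (θ j)]
      refine Submodule.smul_mem _ _ (Submodule.subset_span ⟨j, ?_, rfl⟩)
      simpa [Subtype.ext_iff] using hj
    have := (Submodule.add_mem_iff_left _ hrest).1 (hsub hmem)
    rw [← algebraMap_smul (PS ℓ) (g i) (θ i)] at this
    refine hmin i ?_
    have h2 := Submodule.smul_mem _ (algebraMap ℂ (PS ℓ) (g i)⁻¹) this
    rwa [smul_smul, ← map_mul, inv_mul_cancel₀ hgi, map_one, one_smul] at h2
  rw [genDim, ← hspan, finrank_span_eq_card hli, Fintype.card_subtype]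

theorem HasExp.unique {ℓ : ℕ} {A : Set (PS ℓ)} {M M' : Multiset ℕ} (h : HasExp A M)
    (h' : HasExp A M') : M = M' := by
  classical
  obtain ⟨s, θ, d, hd, ⟨hspan, hmin⟩, rfl⟩ := h
  obtain ⟨s', θ', d', hd', ⟨hspan', hmin'⟩, rfl⟩ := h'
  ext k
  have e := card_degree_eq_genDim hd hmin k
  have e' := card_degree_eq_genDim hd' hmin' k
  rw [hspan] at e
  rw [hspan'] at e'
  rw [Multiset.count_map, Multiset.count_map]
  simp only [eq_comm (a := k)]
  exact e.trans e'.symm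

theorem hasExp_of_fintype {ℓ : ℕ} {A : Set (PS ℓ)} {ι : Type*} [Fintype ι] (θ : ι → Der ℓ)
    (d : ι → ℕ) (hd : ∀ i, IsHomogDer (θ i) (d i))
    (hspan : Submodule.span (PS ℓ) (Set.range θ) = logDer A)
    (hmin : ∀ i, θ i ∉ Submodule.span (PS ℓ) (θ '' {j | j ≠ i})) :
    HasExp A (Multiset.map d Finset.univ.val) := by
  let e := Fintype.equivFin ι
  refine ⟨Fintype.card ι, θ ∘ e.symm, d ∘ e.symm, fun i => hd _, ⟨?_, fun i => ?_⟩, ?_⟩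
  · rw [e.symm.surjective.range_comp, hspan]
  · rw [Set.image_comp]
    have : e.symm '' {j | j ≠ i} = {j | j ≠ e.symm i} := by
      ext j
      simp only [Set.mem_image, Set.mem_ofPred_eq]
      exact ⟨fun ⟨a, ha, h⟩ => h ▸ fun hh => ha (e.symm.injective hh),
        fun hj => ⟨e j, fun hh => hj (by simp [← hh]), by simp⟩⟩
    rw [this]
    exact hmin _
  · rw [← Multiset.map_map]
    congr 1
    have := Finset.map_univ_equiv e.symm
    simp

theorem linearMap_eq_of_X {ℓ : ℕ} {M : Type*} [AddCommMonoid M] [Module ℂ M]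
    {F G : PS ℓ →ₗ[ℂ] M} (h : ∀ i, F (X i) = G (X i)) {β : PS ℓ} (hβ : β.IsHomogeneous 1) :
    F β = G β := by
  rw [← mem_homogeneousSubmodule, homogeneousSubmodule_one_eq_span_X] at hβ
  refine LinearMap.eqOn_span ?_ hβ
  rintro _ ⟨i, rfl⟩
  exact h i

/-- The ideal generated by linear forms is the kernel of a linear projection. -/
theorem exists_algHom_ker_eq_span {ℓ : ℕ} {T : Set (PS ℓ)} (hT : ∀ t ∈ T, t.IsHomogeneous 1) :
    ∃ φ : PS ℓ →ₐ[ℂ] PS ℓ, (∀ p, φ p = 0 ↔ p ∈ Ideal.span T) ∧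
      ∀ β : PS ℓ, β.IsHomogeneous 1 → (φ β = 0 ↔ β ∈ Submodule.span ℂ T) := by
  obtain ⟨W, hW⟩ := Submodule.exists_isCompl (Submodule.span ℂ T)
  set π := Submodule.projection W (Submodule.span ℂ T) hW.symm with hπ
  have hker : ∀ x, π x = 0 ↔ x ∈ Submodule.span ℂ T := fun x => by
    rw [← LinearMap.mem_ker, hπ, Submodule.ker_projection]
  have hsub : ∀ x, π x - x ∈ Submodule.span ℂ T := fun x => by
    rw [← hker, map_sub, sub_eq_zero]
    simp [hπ]
  set φ : PS ℓ →ₐ[ℂ] PS ℓ := aeval fun i => π (X i) with hφ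
  have hlin : ∀ β : PS ℓ, β.IsHomogeneous 1 → φ β = π β := fun β hβ =>
    linearMap_eq_of_X (F := φ.toLinearMap) (G := π) (fun i => by simp [hφ]) hβ
  have hle : (Submodule.span ℂ T : Set (PS ℓ)) ⊆ Ideal.span T := by
    have : Submodule.span ℂ T ≤ (Ideal.span T).restrictScalars ℂ :=
      Submodule.span_le.2 Ideal.subset_span
    exact this
  refine ⟨φ, fun p => ⟨fun hp => ?_, fun hp => ?_⟩, fun β hβ => by rw [hlin β hβ, hker]⟩
  · have hcomp : (Ideal.Quotient.mkₐ ℂ (Ideal.span T)).comp φ =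
        Ideal.Quotient.mkₐ ℂ (Ideal.span T) := by
      refine MvPolynomial.algHom_ext fun i => ?_
      simp only [AlgHom.comp_apply, Ideal.Quotient.mkₐ_eq_mk]
      rw [Ideal.Quotient.eq, hφ, aeval_X]
      exact hle (hsub _)
    have := congrArg (fun ψ => ψ p) hcomp
    simp only [AlgHom.comp_apply, hp, map_zero, Ideal.Quotient.mkₐ_eq_mk] at this
    exact Ideal.Quotient.eq_zero_iff_mem.1 this.symm
  · have : Ideal.span T ≤ RingHom.ker φ := Ideal.span_le.2 fun t ht => by
      rw [SetLike.mem_coe, RingHom.mem_ker, hlin t (hT t ht), hker]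
      exact Submodule.subset_span ht
    exact this hp

theorem isPrime_span_linForms {ℓ : ℕ} {T : Set (PS ℓ)} (hT : ∀ t ∈ T, t.IsHomogeneous 1) :
    (Ideal.span T).IsPrime := by
  obtain ⟨φ, hφ, -⟩ := exists_algHom_ker_eq_span hT
  have : Ideal.span T = RingHom.ker φ := by
    ext p
    rw [RingHom.mem_ker, hφ]
  rw [this]
  exact RingHom.ker_isPrime _

theorem mem_ideal_span_iff_of_linForms {ℓ : ℕ} {T : Set (PS ℓ)}
    (hT : ∀ t ∈ T, t.IsHomogeneous 1) {β : PS ℓ} (hβ : β.IsHomogeneous 1) :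
    β ∈ Ideal.span T ↔ β ∈ Submodule.span ℂ T := by
  obtain ⟨φ, hφ, hφ'⟩ := exists_algHom_ker_eq_span hT
  rw [← hφ, hφ' β hβ]

theorem prime_of_isLinForm {ℓ : ℕ} {α : PS ℓ} (hα : IsLinForm α) : Prime α := by
  rw [← Ideal.span_singleton_prime hα.2]
  exact isPrime_span_linForms (by simpa using hα.1)

/-- Membership modulo `I` in pairwise independent primes passes to their product. -/
theorem mem_sup_span_prod {R : Type*} [CommRing R] (I : Ideal R) (s : Finset R)
    (hp : ∀ β ∈ s, (I ⊔ Ideal.span {β}).IsPrime)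
    (hn : ∀ β ∈ s, ∀ β' ∈ s, β ≠ β' → β' ∉ I ⊔ Ideal.span {β}) {w : R}
    (hw : ∀ β ∈ s, w ∈ I ⊔ Ideal.span {β}) : w ∈ I ⊔ Ideal.span {∏ β ∈ s, β} := by
  classical
  induction s using Finset.induction_on with
  | empty => simp
  | insert β s hβ ih =>
    have hmem := ih (fun γ hγ => hp γ (Finset.mem_insert_of_mem hγ))
      (fun γ hγ γ' hγ' => hn γ (Finset.mem_insert_of_mem hγ) γ' (Finset.mem_insert_of_mem hγ'))
      fun γ hγ => hw γ (Finset.mem_insert_of_mem hγ)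
    have hprime := hp β (Finset.mem_insert_self _ _)
    obtain ⟨a, ha, b, hb, rfl⟩ := Submodule.mem_sup.1 hmem
    obtain ⟨y, rfl⟩ := Ideal.mem_span_singleton'.1 hb
    have h1 : y * ∏ γ ∈ s, γ ∈ I ⊔ Ideal.span {β} :=
      (Submodule.add_mem_iff_right _ (Submodule.mem_sup_left ha)).1
        (hw β (Finset.mem_insert_self _ _))
    have h2 : ∏ γ ∈ s, γ ∉ I ⊔ Ideal.span {β} := fun h => by
      obtain ⟨γ, hγ, hγ'⟩ := (hprime.prod_mem_iff).1 h
      exact hn β (Finset.mem_insert_self _ _) γ (Finset.mem_insert_of_mem hγ)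
        (fun e => hβ (e ▸ hγ)) hγ'
    obtain ⟨a', ha', b', hb', rfl⟩ := Submodule.mem_sup.1
      ((hprime.mem_or_mem h1).resolve_right h2)
    obtain ⟨u, rfl⟩ := Ideal.mem_span_singleton'.1 hb'
    have e : a + (a' + u * β) * ∏ γ ∈ s, γ =
        (a + a' * ∏ γ ∈ s, γ) + u * ∏ γ ∈ insert β s, γ := by
      rw [Finset.prod_insert hβ]
      ring
    rw [e]
    exact add_mem (Submodule.mem_sup_left (add_mem ha (Ideal.mul_mem_right _ _ ha')))
      (Submodule.mem_sup_right (Ideal.mul_mem_left _ _ (Ideal.mem_span_singleton_self _)))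

/-- The constant derivation along a linear functional. -/
def dirDer {ℓ : ℕ} (f : PS ℓ →ₗ[ℂ] ℂ) : Der ℓ := mkDerivation ℂ fun i => C (f (X i))

theorem dirDer_apply {ℓ : ℕ} (f : PS ℓ →ₗ[ℂ] ℂ) {β : PS ℓ} (hβ : β.IsHomogeneous 1) :
    dirDer f β = C (f β) :=
  linearMap_eq_of_X (F := (dirDer f).toLinearMap) (G := (Algebra.linearMap ℂ (PS ℓ)).comp f)
    (fun i => by simp [dirDer, mkDerivation_X, algebraMap_eq]) hβ

theorem isHomogDer_dirDer {ℓ : ℕ} (f : PS ℓ →ₗ[ℂ] ℂ) : IsHomogDer (dirDer f) 0 := fun i => by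
  simpa [dirDer, mkDerivation_X] using isHomogeneous_C _ _

theorem euler_apply {ℓ : ℕ} {β : PS ℓ} (hβ : β.IsHomogeneous 1) : euler ℓ β = β :=
  linearMap_eq_of_X (F := (euler ℓ).toLinearMap) (G := LinearMap.id)
    (fun i => by simp [euler, mkDerivation_X]) hβ

theorem isHomogDer_euler (ℓ : ℕ) : IsHomogDer (euler ℓ) 1 := fun i => by
  simpa [euler, mkDerivation_X] using isHomogeneous_X ℂ i

theorem mem_logDer {ℓ : ℕ} {A : Set (PS ℓ)} {θ : Der ℓ} :
    θ ∈ logDer A ↔ ∀ β ∈ A, β ∣ θ β :=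
  forall₂_congr fun _ _ => Ideal.mem_span_singleton

theorem euler_mem_logDer {ℓ : ℕ} {A : Set (PS ℓ)} (hA : ∀ β ∈ A, IsLinForm β) :
    euler ℓ ∈ logDer A :=
  mem_logDer.2 fun β hβ => by rw [euler_apply (hA β hβ).1]

theorem homogComp_apply {ℓ : ℕ} (k : ℕ) (θ : Der ℓ) {β : PS ℓ} (hβ : β.IsHomogeneous 1) :
    homogComp k θ β = homogeneousComponent k (θ β) :=
  linearMap_eq_of_X (F := (homogComp k θ).toLinearMap)
    (G := (homogeneousComponent k).comp θ.toLinearMap) (fun i => by simp) hβ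

theorem homogComp_mem_logDer {ℓ : ℕ} {A : Set (PS ℓ)} (hA : ∀ β ∈ A, IsLinForm β) (k : ℕ)
    {θ : Der ℓ} (hθ : θ ∈ logDer A) : homogComp k θ ∈ logDer A := by
  refine mem_logDer.2 fun β hβ => ?_
  obtain ⟨g, hg⟩ := mem_logDer.1 hθ β hβ
  rw [homogComp_apply k θ (hA β hβ).1, hg, mul_comm,
    homogeneousComponent_mul_of_isHomogeneous (hA β hβ).1]
  split_ifs
  · exact Dvd.intro_left _ rfl
  · exact dvd_zero _

theorem span_homog_logDer {ℓ : ℕ} {A : Set (PS ℓ)} (hA : ∀ β ∈ A, IsLinForm β) :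
    Submodule.span (PS ℓ) {x | x ∈ logDer A ∧ ∃ k, IsHomogDer x k} = logDer A := by
  refine le_antisymm (Submodule.span_le.2 fun x hx => hx.1) fun θ hθ => ?_
  obtain ⟨n, hn⟩ := exists_sum_homogComp θ
  rw [← hn]
  exact Submodule.sum_mem _ fun k _ => Submodule.subset_span
    ⟨homogComp_mem_logDer hA k hθ, k, isHomogDer_homogComp k θ⟩

theorem isNoetherian_der (ℓ : ℕ) : IsNoetherian (PS ℓ) (Der ℓ) := by
  let F : Der ℓ →ₗ[PS ℓ] (Fin ℓ → PS ℓ) :=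
    { toFun := fun θ i => θ (X i)
      map_add' := fun _ _ => rfl
      map_smul' := fun _ _ => rfl }
  exact isNoetherian_of_injective F fun θ ψ h => derivation_ext fun i => congrFun h i

/-- A set of logarithmic derivations can be completed, by a finite irredundant set of homogeneous
ones, to a generating set. -/
theorem exists_irredundant_homog {ℓ : ℕ} {A : Set (PS ℓ)} (hA : ∀ β ∈ A, IsLinForm β)
    {U : Set (Der ℓ)} (hU : U ⊆ logDer A) :
    ∃ T : Finset (Der ℓ), (∀ t ∈ T, t ∈ logDer A ∧ ∃ k, IsHomogDer t k) ∧
      Submodule.span (PS ℓ) (U ∪ T) = logDer A ∧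
      ∀ t ∈ T, t ∉ Submodule.span (PS ℓ) (U ∪ (T \ {t} : Set (Der ℓ))) := by
  classical
  have := isNoetherian_der ℓ
  obtain ⟨T₀, hT₀, hspan₀⟩ := (Submodule.fg_span_iff_fg_span_finset_subset
    {x : Der ℓ | x ∈ logDer A ∧ ∃ k, IsHomogDer x k}).1 (IsNoetherian.noetherian (R := PS ℓ) _)
  rw [span_homog_logDer hA] at hspan₀
  let P : Finset (Der ℓ) → Prop := fun T =>
    (∀ t ∈ T, t ∈ logDer A ∧ ∃ k, IsHomogDer t k) ∧ Submodule.span (PS ℓ) (U ∪ T) = logDer A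
  have hP₀ : P T₀ := by
    refine ⟨fun t ht => hT₀ ht, le_antisymm (Submodule.span_le.2 ?_) ?_⟩
    · exact Set.union_subset hU fun t ht => (hT₀ ht).1
    · conv_lhs => rw [hspan₀]
      exact Submodule.span_mono Set.subset_union_right
  obtain ⟨T, -, hT⟩ := exists_minimal_le_of_wellFoundedLT P T₀ hP₀
  refine ⟨T, hT.prop.1, hT.prop.2, fun t ht hmem => ?_⟩
  have hP : P (T.erase t) := by
    refine ⟨fun s hs => hT.prop.1 s (Finset.mem_of_mem_erase hs), ?_⟩
    rw [← hT.prop.2, Finset.coe_erase]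
    refine le_antisymm (Submodule.span_mono
      (Set.union_subset_union_right _ Set.sdiff_subset)) (Submodule.span_le.2 ?_)
    rintro s (hs | hs)
    · exact Submodule.subset_span (Or.inl hs)
    · by_cases hst : s = t
      · rw [hst]
        exact hmem
      · exact Submodule.subset_span (Or.inr ⟨hs, hst⟩)
  exact Finset.notMem_erase t T (hT.le_of_le hP (Finset.erase_subset _ _) ht)

theorem linearIndependent_triple_iff {V : Type*} [AddCommGroup V] [Module ℂ V] {x y z : V} :
    LinearIndependent ℂ ![x, y, z] ↔
      ∀ a b c : ℂ, a • x + b • y + c • z = 0 → a = 0 ∧ b = 0 ∧ c = 0 := by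
  rw [Fintype.linearIndependent_iff]
  refine ⟨fun h a b c e => ?_, fun h g e => ?_⟩
  · have := h ![a, b, c] (by simpa [Fin.sum_univ_three] using e)
    exact ⟨this 0, this 1, this 2⟩
  · obtain ⟨h0, h1, h2⟩ := h (g 0) (g 1) (g 2) (by simpa [Fin.sum_univ_three] using e)
    intro i
    fin_cases i <;> assumption

theorem notMem_span_pair_of_triple {V : Type*} [AddCommGroup V] [Module ℂ V] {x y z : V}
    (h : LinearIndependent ℂ ![x, y, z]) : z ∉ Submodule.span ℂ {x, y} := by
  rw [Submodule.mem_span_pair]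
  rintro ⟨a, b, e⟩
  have := (linearIndependent_triple_iff.1 h a b (-1) (by rw [e]; simp)).2.2
  simp at this

theorem exists_dual {V ι : Type*} [AddCommGroup V] [Module ℂ V] {v : ι → V}
    (h : LinearIndependent ℂ v) (w : ι → ℂ) : ∃ f : V →ₗ[ℂ] ℂ, ∀ i, f (v i) = w i := by
  obtain ⟨f, hf⟩ := LinearMap.exists_extend ((Module.Basis.span h).constr ℂ w)
  refine ⟨f, fun i => ?_⟩
  have := LinearMap.congr_fun hf (Module.Basis.span h i)
  rw [Module.Basis.constr_basis] at this
  rw [← this]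
  simp [Module.Basis.span_apply]

theorem finrank_linForms_le : Module.finrank ℂ (homogeneousSubmodule (Fin 3) ℂ 1) ≤ 3 := by
  rw [homogeneousSubmodule_one_eq_span_X]
  exact (finrank_range_le_card (R := ℂ) (b := (X : Fin 3 → PS 3))).trans (by simp)

instance finite_linForms : Module.Finite ℂ (homogeneousSubmodule (Fin 3) ℂ 1) := by
  rw [homogeneousSubmodule_one_eq_span_X]
  exact FiniteDimensional.span_of_finite ℂ (Set.finite_range _)

theorem span_le_linForms {ℓ : ℕ} {A : Set (PS ℓ)} (hA : ∀ β ∈ A, IsLinForm β) :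
    Submodule.span ℂ A ≤ homogeneousSubmodule (Fin ℓ) ℂ 1 :=
  Submodule.span_le.2 fun β hβ => (hA β hβ).1

theorem span_eq_linForms {A : Set (PS 3)} (hA : ∀ β ∈ A, IsLinForm β)
    (h : 3 ≤ Module.finrank ℂ (Submodule.span ℂ A)) :
    Submodule.span ℂ A = homogeneousSubmodule (Fin 3) ℂ 1 :=
  Submodule.eq_of_le_of_finrank_le (span_le_linForms hA) (finrank_linForms_le.trans h)

theorem derivation_eq_of_eqOn {A : Set (PS 3)} (hA : ∀ β ∈ A, IsLinForm β)
    (h : 3 ≤ Module.finrank ℂ (Submodule.span ℂ A)) {θ ψ : Der 3}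
    (e : ∀ β ∈ A, θ β = ψ β) : θ = ψ := by
  refine derivation_ext fun i => ?_
  have hX : (X i : PS 3) ∈ Submodule.span ℂ A := by
    rw [span_eq_linForms hA h]
    exact isHomogeneous_X ℂ i
  exact LinearMap.eqOn_span (f := θ.toLinearMap) (g := ψ.toLinearMap) e hX

theorem range_triple {V : Type*} (x y z : V) : Set.range ![x, y, z] = {x, y, z} := by
  ext
  simp [eq_comm]
  tauto

theorem derivation_eq_of_triple {x y z : PS 3} (hx : IsLinForm x) (hy : IsLinForm y)
    (hz : IsLinForm z) (h : LinearIndependent ℂ ![x, y, z]) {θ ψ : Der 3} (ex : θ x = ψ x)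
    (ey : θ y = ψ y) (ez : θ z = ψ z) : θ = ψ := by
  refine derivation_eq_of_eqOn (A := {x, y, z}) ?_ ?_ ?_
  · rintro β (rfl | rfl | rfl) <;> assumption
  · rw [← range_triple, finrank_span_eq_card h]
    simp
  · rintro β (rfl | rfl | rfl) <;> assumption

theorem range_pair {V : Type*} (x y : V) : Set.range ![x, y] = {x, y} := by
  ext
  simp [eq_comm]
  tauto

theorem rk_pair_iff {ℓ : ℕ} (x y : PS ℓ) :
    rk {x, y} = 2 ↔ LinearIndependent ℂ ![x, y] := by
  rw [linearIndependent_iff_card_eq_finrank_span, rk, Set.finrank, range_pair, Finset.coe_pair,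
    Fintype.card_fin, eq_comm]

theorem rk_triple_iff {ℓ : ℕ} (x y z : PS ℓ) :
    rk {x, y, z} = 3 ↔ LinearIndependent ℂ ![x, y, z] := by
  rw [linearIndependent_iff_card_eq_finrank_span, rk, Set.finrank, range_triple,
    Finset.coe_insert, Finset.coe_pair, Fintype.card_fin, eq_comm]

theorem span_singleton_ideal_sup {R : Type*} [CommRing R] (x y : R) :
    Ideal.span {x} ⊔ Ideal.span {y} = Ideal.span {x, y} := by
  rw [← Ideal.span_union, Set.singleton_union]

theorem not_dvd_of_linearIndependent {ℓ : ℕ} {x y : PS ℓ} (hx : IsLinForm x) (hy : IsLinForm y)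
    (h : LinearIndependent ℂ ![x, y]) : ¬ x ∣ y := by
  rw [← Ideal.mem_span_singleton, mem_ideal_span_iff_of_linForms (by simpa using hx.1) hy.1,
    Submodule.mem_span_singleton]
  rintro ⟨c, hc⟩
  have := (LinearIndependent.pair_iff.1 h c (-1) (by rw [hc]; simp)).2
  simp at this

theorem dirDer_prod_mem_logDer {ℓ : ℕ} {A : Finset (PS ℓ)} (hA : ∀ β ∈ A, IsLinForm β)
    {z : PS ℓ} (f : PS ℓ →ₗ[ℂ] ℂ) (hfz : f z = 0) :
    (∏ β ∈ A.erase z, β) • dirDer f ∈ logDer (A : Set (PS ℓ)) := by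
  refine mem_logDer.2 fun β hβ => ?_
  rw [Derivation.smul_apply, dirDer_apply f (hA β hβ).1, smul_eq_mul]
  by_cases h : β = z
  · simp [h, hfz]
  · exact Dvd.dvd.mul_right (Finset.dvd_prod_of_mem (fun β => β)
      (Finset.mem_erase.2 ⟨h, hβ⟩)) _

theorem mem_logDer_insert {ℓ : ℕ} {A : Finset (PS ℓ)} {α : PS ℓ} {θ : Der ℓ} :
    θ ∈ logDer ((insert α A : Finset (PS ℓ)) : Set (PS ℓ)) ↔
      α ∣ θ α ∧ θ ∈ logDer (A : Set (PS ℓ)) := by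
  simp [mem_logDer]

/-- Modulo `α D(A)`, the module of the arrangement with a generic plane added is generated by the
Euler derivation and one further derivation. -/
theorem exists_decomp_of_mem_logDer_insert {A : Finset (PS 3)} (hA : ∀ β ∈ A, IsLinForm β)
    {α x z : PS 3} (hα : IsLinForm α) (hx : IsLinForm x) (hz : z ∈ A)
    (hli : LinearIndependent ℂ ![α, x, z])
    (hgen : ∀ β ∈ A, ∀ β' ∈ A, β ≠ β' → LinearIndependent ℂ ![α, β, β'])
    (hndvd : ∀ β ∈ A, ¬ β ∣ α) {f : PS 3 →ₗ[ℂ] ℂ} (hfα : f α = 0) (hfx : f x = 1)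
    (hfz : f z = 0) {θ : Der 3}
    (hθ : θ ∈ logDer ((insert α A : Finset (PS 3)) : Set (PS 3))) :
    ∃ u v : PS 3, ∃ ψ ∈ logDer (A : Set (PS 3)),
      θ = u • euler 3 + v • ((∏ β ∈ A.erase z, β) • dirDer f) + α • ψ := by
  obtain ⟨hθα, hθA⟩ := mem_logDer_insert.1 hθ
  obtain ⟨g, hg⟩ := exists_dual hli ![1, 0, 0]
  have hgα : g α = 1 := hg 0
  have hgx : g x = 0 := hg 1
  have hgz : g z = 0 := hg 2
  have hzl := hA z hz
  obtain ⟨h, hh⟩ := mem_logDer.1 hθA z hz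
  obtain ⟨θ', hθ'⟩ : ∃ θ', θ' = θ - h • euler 3 := ⟨_, rfl⟩
  have hθ'A : θ' ∈ logDer (A : Set (PS 3)) := by
    rw [hθ']
    exact sub_mem hθA (Submodule.smul_mem _ _ (euler_mem_logDer hA))
  have hθ'z : θ' z = 0 := by
    rw [hθ', Derivation.sub_apply, Derivation.smul_apply, euler_apply hzl.1, hh, smul_eq_mul]
    ring
  obtain ⟨u, hu⟩ : α ∣ θ' α := by
    rw [hθ', Derivation.sub_apply, Derivation.smul_apply, euler_apply hα.1]
    exact dvd_sub hθα (Dvd.intro_left _ rfl)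
  have hdec : θ' = (α * u) • dirDer g + θ' x • dirDer f := by
    refine derivation_eq_of_triple hα hx hzl hli ?_ ?_ ?_ <;>
      simp only [Derivation.add_apply, Derivation.smul_apply, dirDer_apply _ hα.1,
        dirDer_apply _ hx.1, dirDer_apply _ hzl.1, hgα, hgx, hgz, hfα, hfx, hfz, hu, hθ'z,
        map_zero, map_one, smul_eq_mul] <;> ring
  have hfβ : ∀ β ∈ A.erase z, f β ≠ 0 := fun β hβ h0 => by
    obtain ⟨hne, hβA⟩ := Finset.mem_erase.1 hβ
    have : dirDer f = 0 := derivation_eq_of_triple hα (hA β hβA) hzl (hgen β hβA z hz hne)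
      (by simp [dirDer_apply _ hα.1, hfα]) (by simp [dirDer_apply _ (hA β hβA).1, h0])
      (by simp [dirDer_apply _ hzl.1, hfz])
    have h1 := dirDer_apply f hx.1
    rw [this, hfx] at h1
    simp at h1
  have hw : θ' x ∈ Ideal.span {α} ⊔ Ideal.span {∏ β ∈ A.erase z, β} := by
    have hlin : ∀ β ∈ A, ∀ t ∈ ({α, β} : Set (PS 3)), t.IsHomogeneous 1 := by
      rintro β hβ t (rfl | rfl)
      exacts [hα.1, (hA _ hβ).1]
    refine mem_sup_span_prod _ _ (fun β hβ => ?_) (fun β hβ β' hβ' hne => ?_) fun β hβ => ?_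
    · rw [span_singleton_ideal_sup]
      exact isPrime_span_linForms (hlin β (Finset.mem_of_mem_erase hβ))
    · have h1 := Finset.mem_of_mem_erase hβ
      have h2 := Finset.mem_of_mem_erase hβ'
      rw [span_singleton_ideal_sup, mem_ideal_span_iff_of_linForms (hlin β h1) (hA β' h2).1]
      exact notMem_span_pair_of_triple (hgen β h1 β' h2 hne)
    · have h1 := Finset.mem_of_mem_erase hβ
      have h2 : θ' x * C (f β) ∈ Ideal.span {α} ⊔ Ideal.span {β} := by
        have e : θ' x * C (f β) = θ' β - α * (u * C (g β)) := by
          conv_rhs => rw [hdec]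
          simp only [Derivation.add_apply, Derivation.smul_apply, dirDer_apply _ (hA β h1).1,
            smul_eq_mul]
          ring
        rw [e]
        exact sub_mem
          (Submodule.mem_sup_right (Ideal.mem_span_singleton.2 (mem_logDer.1 hθ'A β h1)))
          (Submodule.mem_sup_left (Ideal.mem_span_singleton.2 (Dvd.intro _ rfl)))
      have h3 := Ideal.mul_mem_right (C (f β)⁻¹) _ h2
      rwa [mul_assoc, ← C_mul, mul_inv_cancel₀ (hfβ β hβ), C_1, mul_one] at h3
  obtain ⟨a, ha, b, hb, hab⟩ := Submodule.mem_sup.1 hw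
  obtain ⟨w, rfl⟩ := Ideal.mem_span_singleton'.1 ha
  obtain ⟨v, rfl⟩ := Ideal.mem_span_singleton'.1 hb
  have hθ'' : θ' = v • ((∏ β ∈ A.erase z, β) • dirDer f) +
      α • (u • dirDer g + w • dirDer f) := by
    conv_lhs => rw [hdec, ← hab]
    module
  refine ⟨h, v, u • dirDer g + w • dirDer f, mem_logDer.2 fun β hβ => ?_, ?_⟩
  · have h1 : α • (u • dirDer g + w • dirDer f) ∈ logDer (A : Set (PS 3)) := by
      rw [← sub_eq_of_eq_add' hθ'']
      exact sub_mem hθ'A (Submodule.smul_mem _ _ (dirDer_prod_mem_logDer hA f hfz))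
    have h2 := mem_logDer.1 h1 β hβ
    rw [Derivation.smul_apply, smul_eq_mul] at h2
    exact ((prime_of_isLinForm (hA β hβ)).dvd_or_dvd h2).resolve_left (hndvd β hβ)
  · rw [add_assoc, ← hθ'', hθ']
    abel

/-- The Euler derivation and the additional generator are independent modulo `α`. -/
theorem dvd_of_smul_euler_add_eq_smul {A : Finset (PS 3)} (hA : ∀ β ∈ A, IsLinForm β)
    {α x z : PS 3} (hα : IsLinForm α) (hx : IsLinForm x) (hz : z ∈ A)
    (hndvd : ∀ β ∈ A, ¬ α ∣ β) {f : PS 3 →ₗ[ℂ] ℂ} (hfx : f x = 1) (hfz : f z = 0)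
    {u v : PS 3} {ψ : Der 3}
    (h : u • euler 3 + v • ((∏ β ∈ A.erase z, β) • dirDer f) = α • ψ) : α ∣ u ∧ α ∣ v := by
  have hp := prime_of_isLinForm hα
  have hz' := congrArg (fun θ : Der 3 => θ z) h
  have hx' := congrArg (fun θ : Der 3 => θ x) h
  simp only [Derivation.add_apply, Derivation.smul_apply, dirDer_apply _ hx.1,
    dirDer_apply _ (hA z hz).1, euler_apply hx.1, euler_apply (hA z hz).1, hfx, hfz, map_zero,
    map_one, smul_eq_mul, mul_zero, add_zero, mul_one] at hz' hx'
  have hu : α ∣ u := (hp.dvd_or_dvd (Dvd.intro _ hz'.symm)).resolve_right (hndvd z hz)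
  refine ⟨hu, ?_⟩
  have h1 : α ∣ v * ∏ β ∈ A.erase z, β :=
    (dvd_add_right (hu.mul_right x)).1 (Dvd.intro _ hx'.symm)
  refine (hp.dvd_or_dvd h1).resolve_right fun h2 => ?_
  obtain ⟨β, hβ, hβ'⟩ := (hp.dvd_finsetProd_iff _).1 h2
  exact hndvd β (Finset.mem_of_mem_erase hβ) hβ'

/-- The additional generator is not a minimal generator of `D(A)` when `A` has rank three. -/
theorem exists_dirDer_prod_eq {A : Finset (PS 3)} (hA : ∀ β ∈ A, IsLinForm β) {x y z : PS 3}
    (hx : x ∈ A) (hy : y ∈ A) (hz : z ∈ A) (hli : LinearIndependent ℂ ![x, y, z])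
    {f : PS 3 →ₗ[ℂ] ℂ} (hfz : f z = 0) :
    ∃ ψ₁ ∈ logDer (A : Set (PS 3)), ∃ ψ₂ ∈ logDer (A : Set (PS 3)),
      (∏ β ∈ A.erase z, β) • dirDer f = y • ψ₁ + x • ψ₂ := by
  obtain ⟨p, hp⟩ := exists_dual hli ![1, 0, 0]
  obtain ⟨q, hq⟩ := exists_dual hli ![0, 1, 0]
  have hpx : p x = 1 := hp 0
  have hpy : p y = 0 := hp 1
  have hpz : p z = 0 := hp 2
  have hqx : q x = 0 := hq 0
  have hqy : q y = 1 := hq 1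
  have hqz : q z = 0 := hq 2
  have hxz : x ≠ z := fun e => by simp [e, hpz] at hpx
  have hyz : y ≠ z := fun e => by simp [e, hqz] at hqy
  have hxy : x ≠ y := fun e => by simp [e, hpy] at hpx
  set P := ∏ β ∈ ((A.erase z).erase x).erase y, β with hP
  have hprod : ∏ β ∈ A.erase z, β = x * (y * P) := by
    rw [hP, Finset.mul_prod_erase _ (fun β => β) (Finset.mem_erase.2 ⟨hxy.symm,
      Finset.mem_erase.2 ⟨hyz, hy⟩⟩),
      Finset.mul_prod_erase _ (fun β => β) (Finset.mem_erase.2 ⟨hxz, hx⟩)]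
  refine ⟨(P * x * C (f x)) • dirDer p, mem_logDer.2 fun β hβ => ?_,
    (P * y * C (f y)) • dirDer q, mem_logDer.2 fun β hβ => ?_, ?_⟩
  · rw [Derivation.smul_apply, dirDer_apply _ (hA β hβ).1, smul_eq_mul]
    by_cases h1 : β = x
    · exact ⟨P * C (f x) * C (p β), by rw [h1]; ring⟩
    by_cases h2 : β = y
    · simp [h2, hpy]
    by_cases h3 : β = z
    · simp [h3, hpz]
    obtain ⟨r, hr⟩ : β ∣ P := Finset.dvd_prod_of_mem (fun β => β) (by simp [h1, h2, h3]; exact hβ)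
    exact ⟨r * x * C (f x) * C (p β), by rw [hr]; ring⟩
  · rw [Derivation.smul_apply, dirDer_apply _ (hA β hβ).1, smul_eq_mul]
    by_cases h1 : β = y
    · exact ⟨P * C (f y) * C (q β), by rw [h1]; ring⟩
    by_cases h2 : β = x
    · simp [h2, hqx]
    by_cases h3 : β = z
    · simp [h3, hqz]
    obtain ⟨r, hr⟩ : β ∣ P := Finset.dvd_prod_of_mem (fun β => β) (by simp [h1, h2, h3]; exact hβ)
    exact ⟨r * y * C (f y) * C (q β), by rw [hr]; ring⟩
  · refine derivation_eq_of_triple (hA x hx) (hA y hy) (hA z hz) hli ?_ ?_ ?_ <;>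
      simp only [Derivation.add_apply, Derivation.smul_apply, dirDer_apply _ (hA x hx).1,
        dirDer_apply _ (hA y hy).1, dirDer_apply _ (hA z hz).1, hpx, hpy, hpz, hqx, hqy, hqz,
        hfz, hprod, map_zero, map_one, smul_eq_mul] <;> ring

theorem homogComp_mem_span {ℓ : ℕ} {S : Set (Der ℓ)} (hS : ∀ s ∈ S, ∃ k, IsHomogDer s k)
    (k : ℕ) {x : Der ℓ} (hx : x ∈ Submodule.span (PS ℓ) S) :
    homogComp k x ∈ Submodule.span (PS ℓ) S := by
  obtain ⟨n, c, g, rfl⟩ := Submodule.mem_span_set'.1 hx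
  choose d hd using fun i => hS (g i) (g i).2
  rw [homogComp_sum_smul hd]
  refine Submodule.sum_mem _ fun i _ => ?_
  split_ifs
  · exact Submodule.smul_mem _ _ (Submodule.subset_span (g i).2)
  · exact zero_mem _

/-- Graded Nakayama for one generator: a factor with constant coefficient one cancels. -/
theorem mem_span_of_smul_mem_span {ℓ : ℕ} {S : Set (Der ℓ)}
    (hS : ∀ s ∈ S, ∃ k, IsHomogDer s k) {t : Der ℓ} {d : ℕ} (ht : IsHomogDer t d) {p : PS ℓ}
    (hp : coeff 0 p = 1) (h : p • t ∈ Submodule.span (PS ℓ) S) :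
    t ∈ Submodule.span (PS ℓ) S := by
  have := homogComp_mem_span hS d h
  rwa [homogComp_smul ht, if_pos le_rfl, Nat.sub_self, homogeneousComponent_zero, hp, C_1,
    one_smul] at this

theorem eq_zero_of_isHomogDer_zero {A : Finset (PS 3)} (hA : ∀ β ∈ A, IsLinForm β)
    (h3 : 3 ≤ rk A) {θ : Der 3} (hθ : θ ∈ logDer (A : Set (PS 3))) (h0 : IsHomogDer θ 0) :
    θ = 0 := by
  refine derivation_eq_of_eqOn hA h3 fun β hβ => ?_
  obtain ⟨g, hg⟩ := mem_logDer.1 hθ β hβ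
  have e := homogComp_apply 0 θ (hA β hβ).1
  rw [homogComp_of_isHomogDer h0, hg, mul_comm,
    homogeneousComponent_mul_of_isHomogeneous (hA β hβ).1, if_neg (by norm_num)] at e
  rw [hg, mul_comm, e, Derivation.zero_apply]

theorem exists_hasExp {ℓ : ℕ} {A : Set (PS ℓ)} (hA : ∀ β ∈ A, IsLinForm β) :
    ∃ M, HasExp A M := by
  obtain ⟨T, hT, hspan, hirr⟩ := exists_irredundant_homog hA (Set.empty_subset _)
  choose d hd using fun t : T => (hT t t.2).2
  refine ⟨_, hasExp_of_fintype (fun t : T => (t : Der ℓ)) d hd ?_ fun t ht => hirr t t.2 ?_⟩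
  · rw [← hspan]
    simp
  · refine Submodule.span_mono ?_ ht
    rintro _ ⟨s, hs, rfl⟩
    exact Or.inr ⟨s.2, fun h => hs (Subtype.ext h)⟩

theorem isHomogDer_prod_smul_dirDer {ℓ : ℕ} {s : Finset (PS ℓ)} (hs : ∀ β ∈ s, IsLinForm β)
    (f : PS ℓ →ₗ[ℂ] ℂ) : IsHomogDer ((∏ β ∈ s, β) • dirDer f) s.card := by
  have := IsHomogDer.smul (IsHomogeneous.prod s (fun β => β) (fun _ => 1)
    fun β hβ => (hs β hβ).1) (isHomogDer_dirDer f)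
  simpa using this

theorem euler_notMem_span {A : Finset (PS 3)} (hA : ∀ β ∈ A, IsLinForm β) (h3 : 3 ≤ rk A)
    {T : Finset (Der 3)} (hT : ∀ t ∈ T, t ∈ logDer (A : Set (PS 3)) ∧ ∃ k, IsHomogDer t k)
    (hirr : ∀ t ∈ T, t ∉ Submodule.span (PS 3) ({euler 3} ∪ (T \ {t} : Set (Der 3)))) :
    euler 3 ∉ Submodule.span (PS 3) (T : Set (Der 3)) := by
  classical
  intro hE
  choose d hd using fun t : T => (hT t t.2).2
  have hE' : euler 3 ∈ Submodule.span (PS 3) (Set.range fun t : T => (t : Der 3)) := by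
    simpa using hE
  obtain ⟨c, hc⟩ := exists_sub_sum_mem_span (θ := fun t : T => (t : Der 3)) hd
    (isHomogDer_euler 3) hE'
  have hbot : Submodule.span (PS 3) ((fun t : T => (t : Der 3)) '' {t | d t < 1}) = ⊥ := by
    rw [Submodule.span_eq_bot]
    rintro _ ⟨t, ht, rfl⟩
    have h0 := hd t
    rw [Nat.lt_one_iff.1 ht] at h0
    exact eq_zero_of_isHomogDer_zero hA h3 (hT t t.2).1 h0
  rw [hbot, Submodule.mem_bot, sub_eq_zero] at hc
  have hne : euler 3 ≠ 0 := fun h => by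
    have := congrArg (fun θ : Der 3 => θ (X 0)) h
    simp [euler, mkDerivation_X] at this
  obtain ⟨t, ht, hct⟩ := Finset.exists_ne_zero_of_sum_ne_zero (hc ▸ hne)
  have hct' : c t ≠ 0 := fun h => hct (by rw [h, zero_smul])
  refine hirr t t.2 ?_
  rw [← Finset.add_sum_erase _ _ ht] at hc
  have h1 : c t • (t : Der 3) ∈ Submodule.span (PS 3)
      ({euler 3} ∪ ((T : Set (Der 3)) \ {(t : Der 3)})) := by
    rw [← sub_eq_of_eq_add hc]
    refine sub_mem (Submodule.subset_span (Or.inl rfl)) (Submodule.sum_mem _ fun s hs => ?_)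
    rw [← algebraMap_smul (PS 3) (c s) (s : Der 3)]
    exact Submodule.smul_mem _ _ (Submodule.subset_span
      (Or.inr ⟨s.2, fun h => (Finset.mem_erase.1 hs).1 (Subtype.ext h)⟩))
  rw [← algebraMap_smul (PS 3) (c t) (t : Der 3)] at h1
  have h2 := Submodule.smul_mem _ (algebraMap ℂ (PS 3) (c t)⁻¹) h1
  rwa [smul_smul, ← map_mul, inv_mul_cancel₀ hct', map_one, one_smul] at h2

theorem exists_linearIndependent_triple {A : Finset (PS 3)} (h3 : 3 ≤ rk A) :
    ∃ x ∈ A, ∃ y ∈ A, ∃ z ∈ A, LinearIndependent ℂ ![x, y, z] := by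
  have : Module.Finite ℂ (Submodule.span ℂ (A : Set (PS 3))) :=
    FiniteDimensional.span_finset ℂ A
  obtain ⟨v, hv, -, hli⟩ := Submodule.exists_fun_fin_finrank_span_eq ℂ (A : Set (PS 3))
  have h := hli.comp (Fin.castLE h3) (Fin.castLE_injective h3)
  refine ⟨_, hv (Fin.castLE h3 0), _, hv (Fin.castLE h3 1), _, hv (Fin.castLE h3 2), ?_⟩
  have e : (![v (Fin.castLE h3 0), v (Fin.castLE h3 1), v (Fin.castLE h3 2)] : Fin 3 → PS 3) =
      v ∘ Fin.castLE h3 := by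
    funext i
    fin_cases i <;> rfl
  rw [e]
  exact h

theorem map_univ_val_option {ι : Type*} [Fintype ι] {κ : Type*} (f : Option ι → κ) :
    Multiset.map f Finset.univ.val =
      f none ::ₘ Multiset.map (fun i => f (some i)) Finset.univ.val := by
  have h : (Finset.univ : Finset (Option ι)).val = none ::ₘ Finset.univ.val.map some := rfl
  rw [h, Multiset.map_cons, Multiset.map_map]
  rfl

theorem smul_der_cancel {ℓ : ℕ} {α : PS ℓ} (hα : α ≠ 0) {θ ψ : Der ℓ}
    (h : α • θ = α • ψ) : θ = ψ :=
  derivation_ext fun i => mul_left_cancel₀ hα (congrArg (fun ξ : Der ℓ => ξ (X i)) h)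

/-- Exponents before and after adding a generic plane to an arrangement of rank three. -/
theorem exists_hasExp_insert {A : Finset (PS 3)} (hA : ∀ β ∈ A, IsLinForm β) {α : PS 3}
    (hα : IsLinForm α) (h3 : 3 ≤ rk A) (hpair : ∀ β ∈ A, LinearIndependent ℂ ![α, β])
    (hgen : ∀ β ∈ A, ∀ β' ∈ A, β ≠ β' → LinearIndependent ℂ ![α, β, β']) :
    ∃ M : Multiset ℕ, HasExp (A : Set (PS 3)) (1 ::ₘ M) ∧
      HasExp ((insert α A : Finset (PS 3)) : Set (PS 3))
        ((A.card - 1) ::ₘ 1 ::ₘ M.map (· + 1)) := by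
  classical
  obtain ⟨x, hx, y, hy, z, hz, hli⟩ := exists_linearIndependent_triple h3
  have hxz : x ≠ z := fun e => by
    have := hli.injective.ne (show (0 : Fin 3) ≠ 2 by decide)
    exact this e
  have hβα : ∀ β ∈ A, ¬ β ∣ α := fun β hβ =>
    not_dvd_of_linearIndependent (hA β hβ) hα (LinearIndependent.pair_symm_iff.1 (hpair β hβ))
  have hαβ : ∀ β ∈ A, ¬ α ∣ β := fun β hβ =>
    not_dvd_of_linearIndependent hα (hA β hβ) (hpair β hβ)
  have hli' := hgen x hx z hz hxz
  obtain ⟨f, hf⟩ := exists_dual hli' ![0, 1, 0]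
  have hfα : f α = 0 := hf 0
  have hfx : f x = 1 := hf 1
  have hfz : f z = 0 := hf 2
  obtain ⟨η, hη⟩ : ∃ η, η = (∏ β ∈ A.erase z, β) • dirDer f := ⟨_, rfl⟩
  have hηA : η ∈ logDer (A : Set (PS 3)) := hη ▸ dirDer_prod_mem_logDer hA f hfz
  have hηdeg : IsHomogDer η (A.card - 1) := by
    rw [hη, ← Finset.card_erase_of_mem hz]
    exact isHomogDer_prod_smul_dirDer (fun β hβ => hA β (Finset.mem_of_mem_erase hβ)) f
  have hαindep : ∀ {u v : PS 3} {ψ : Der 3}, u • euler 3 + v • η = α • ψ → α ∣ u ∧ α ∣ v := by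
    intro u v ψ h
    rw [hη] at h
    exact dvd_of_smul_euler_add_eq_smul hA hα (hA x hx) hz hαβ hfx hfz h
  have hα1 : ¬ α ∣ 1 := fun h => (prime_of_isLinForm hα).not_isUnit (isUnit_of_dvd_one h)
  obtain ⟨T, hT, hspan, hirr⟩ := exists_irredundant_homog (A := (A : Set (PS 3))) hA
    (U := {euler 3}) (by simpa using euler_mem_logDer (A := (A : Set (PS 3))) hA)
  have hET := euler_notMem_span hA h3 hT hirr
  choose d hd using fun t : T => (hT t t.2).2
  refine ⟨Multiset.map d Finset.univ.val, ?_, ?_⟩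
  · have key := hasExp_of_fintype (A := (A : Set (PS 3)))
      (fun o : Option T => o.elim (euler 3) fun t => (t : Der 3)) (fun o => o.elim 1 d)
      (by rintro (_ | t); exacts [isHomogDer_euler 3, hd t]) ?_ ?_
    · rwa [map_univ_val_option] at key
    · rw [← hspan]
      congr 1
      ext θ
      simp [Option.exists, eq_comm]
    · rintro (_ | t) h
      · refine hET (Submodule.span_mono ?_ h)
        rintro _ ⟨_ | s, hs, rfl⟩
        exacts [absurd rfl hs, s.2]
      · refine hirr t t.2 (Submodule.span_mono ?_ h)
        rintro _ ⟨_ | s, hs, rfl⟩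
        · exact Or.inl rfl
        · exact Or.inr ⟨s.2, fun e => hs (congrArg some (Subtype.ext e))⟩
  · let Φ : Der 3 →ₗ[PS 3] Der 3 := LinearMap.lsmul (PS 3) (Der 3) α
    have key := hasExp_of_fintype (A := ((insert α A : Finset (PS 3)) : Set (PS 3)))
      (fun o : Option (Option T) =>
        o.elim η fun o => o.elim (euler 3) fun t => α • (t : Der 3))
      (fun o => o.elim (A.card - 1) fun o => o.elim 1 fun t => d t + 1)
      (by
        rintro (_ | _ | t)
        · exact hηdeg
        · exact isHomogDer_euler 3
        · simpa [add_comm] using (hd t).smul hα.1) ?_ ?_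
    · rw [map_univ_val_option, map_univ_val_option] at key
      rw [Multiset.map_map]
      exact key
    · set R := Set.range fun o : Option (Option T) =>
        o.elim η fun o => o.elim (euler 3) fun t => α • (t : Der 3) with hR
      have hEmem : euler 3 ∈ Submodule.span (PS 3) R := Submodule.subset_span ⟨some none, rfl⟩
      refine le_antisymm (Submodule.span_le.2 ?_) fun θ hθ => ?_
      · rintro _ ⟨_ | _ | t, rfl⟩
        · exact mem_logDer_insert.2 ⟨by simp [hη, dirDer_apply _ hα.1, hfα], hηA⟩
        · exact mem_logDer_insert.2 ⟨by simp [euler_apply hα.1], euler_mem_logDer hA⟩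
        · exact mem_logDer_insert.2 ⟨by simp, Submodule.smul_mem _ _ (hT t t.2).1⟩
      · obtain ⟨u, v, ψ, hψ, rfl⟩ := exists_decomp_of_mem_logDer_insert hA hα (hA x hx) hz hli'
          hgen hβα hfα hfx hfz hθ
        refine add_mem (add_mem (Submodule.smul_mem _ _ hEmem) (Submodule.smul_mem _ _
          (Submodule.subset_span ⟨none, hη⟩))) ?_
        have hle : Submodule.span (PS 3) ({euler 3} ∪ (T : Set (Der 3))) ≤
            (Submodule.span (PS 3) R).comap Φ := by
          refine Submodule.span_le.2 ?_
          rintro t (rfl | ht)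
          · exact Submodule.smul_mem _ _ hEmem
          · exact Submodule.subset_span ⟨some (some ⟨t, ht⟩), rfl⟩
        rw [hspan] at hle
        exact hle hψ
    · have himage : ∀ S : Set (Der 3), ∀ ψ ∈ Submodule.span (PS 3) ((α • ·) '' S),
          ∃ k ∈ Submodule.span (PS 3) S, ψ = α • k := by
        intro S ψ hψ
        have : Submodule.span (PS 3) ((α • ·) '' S) = (Submodule.span (PS 3) S).map Φ :=
          (Submodule.map_span Φ S).symm
        rw [this] at hψ
        obtain ⟨k, hk, rfl⟩ := hψ
        exact ⟨k, hk, rfl⟩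
      rintro (_ | _ | t) h
      · have h1 : η ∈ Submodule.span (PS 3) (insert (euler 3) ((α • ·) '' (T : Set (Der 3)))) := by
          refine Submodule.span_mono ?_ h
          rintro _ ⟨_ | _ | s, hs, rfl⟩
          exacts [absurd rfl hs, Or.inl rfl, Or.inr ⟨s, s.2, rfl⟩]
        obtain ⟨b, ψ, hψ, e⟩ := Submodule.mem_span_insert.1 h1
        obtain ⟨k, -, rfl⟩ := himage _ _ hψ
        refine hα1 (hαindep (u := -b) (v := 1) (ψ := k) ?_).2
        conv_lhs => rw [e]
        module
      · have h1 : euler 3 ∈ Submodule.span (PS 3) (insert η ((α • ·) '' (T : Set (Der 3)))) := by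
          refine Submodule.span_mono ?_ h
          rintro _ ⟨_ | _ | s, hs, rfl⟩
          exacts [Or.inl rfl, absurd rfl hs, Or.inr ⟨s, s.2, rfl⟩]
        obtain ⟨b, ψ, hψ, e⟩ := Submodule.mem_span_insert.1 h1
        obtain ⟨k, -, rfl⟩ := himage _ _ hψ
        refine hα1 (hαindep (u := 1) (v := -b) (ψ := k) ?_).1
        conv_lhs => rw [e]
        module
      · set K := Submodule.span (PS 3) ({euler 3} ∪ ((T : Set (Der 3)) \ {(t : Der 3)}))
        have h1 : α • (t : Der 3) ∈ Submodule.span (PS 3)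
            (insert η (insert (euler 3) ((α • ·) '' ((T : Set (Der 3)) \ {(t : Der 3)})))) := by
          refine Submodule.span_mono ?_ h
          rintro _ ⟨_ | _ | s, hs, rfl⟩
          · exact Or.inl rfl
          · exact Or.inr (Or.inl rfl)
          · refine Or.inr (Or.inr ⟨s, ⟨s.2, fun e => hs ?_⟩, rfl⟩)
            exact congrArg (fun s => some (some s)) (Subtype.ext e)
        obtain ⟨a, ψ, hψ, e⟩ := Submodule.mem_span_insert.1 h1
        obtain ⟨b, ψ', hψ', rfl⟩ := Submodule.mem_span_insert.1 hψ
        obtain ⟨k, hk, rfl⟩ := himage _ _ hψ'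
        obtain ⟨⟨b, rfl⟩, ⟨a, rfl⟩⟩ := hαindep (u := b) (v := a) (ψ := (t : Der 3) - k) (by
          rw [smul_sub, e]
          abel)
        have et : (t : Der 3) = a • η + b • euler 3 + k := by
          refine smul_der_cancel hα.2 ?_
          rw [e]
          simp only [smul_add, smul_smul, add_assoc]
        have hmemK : ∀ ψ ∈ logDer (A : Set (PS 3)), ∃ c : PS 3, ∃ k ∈ K, ψ = c • (t : Der 3) + k := by
          intro ψ hψ
          rw [← hspan] at hψ
          refine Submodule.mem_span_insert.1 (Submodule.span_mono ?_ hψ)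
          rintro s (hs | hs)
          · exact Or.inr (Or.inl hs)
          · by_cases hst : s = t
            exacts [Or.inl hst, Or.inr (Or.inr ⟨hs, hst⟩)]
        obtain ⟨ψ₁, h₁, ψ₂, h₂, e'⟩ := exists_dirDer_prod_eq hA hx hy hz hli hfz
        rw [← hη] at e'
        obtain ⟨c₁, k₁, hk₁, rfl⟩ := hmemK ψ₁ h₁
        obtain ⟨c₂, k₂, hk₂, rfl⟩ := hmemK ψ₂ h₂
        refine hirr t t.2 (mem_span_of_smul_mem_span (p := 1 - a * (y * c₁ + x * c₂)) ?_
          (hd t) ?_ ?_)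
        · rintro s (rfl | hs)
          exacts [⟨1, isHomogDer_euler 3⟩, (hT s hs.1).2]
        · have h0 : ∀ β ∈ A, constantCoeff β = 0 := fun β hβ => by
            rw [constantCoeff_eq]
            exact (hA β hβ).1.coeff_eq_zero (by simp)
          rw [← constantCoeff_eq]
          simp [h0 x hx, h0 y hy]
        · have : (1 - a * (y * c₁ + x * c₂)) • (t : Der 3) =
              a • (y • k₁ + x • k₂) + b • euler 3 + k := by
            refine derivation_ext fun i => ?_
            have i₁ := congrArg (fun θ : Der 3 => θ (X i)) et
            have i₂ := congrArg (fun θ : Der 3 => θ (X i)) e'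
            simp only [Derivation.add_apply, Derivation.smul_apply, smul_eq_mul] at i₁ i₂ ⊢
            linear_combination i₁ + a * i₂
          rw [this]
          refine add_mem (add_mem (Submodule.smul_mem _ _ (add_mem (Submodule.smul_mem _ _ hk₁)
            (Submodule.smul_mem _ _ hk₂))) (Submodule.smul_mem _ _
            (Submodule.subset_span (Or.inl rfl)))) (Submodule.span_mono ?_ hk)
          exact Set.subset_union_right

theorem exists_isLinForm_notMem {V : Submodule ℂ (PS 3)} [Module.Finite ℂ V]
    (h : Module.finrank ℂ V < 3) : ∃ γ : PS 3, IsLinForm γ ∧ γ ∉ V := by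
  by_contra! hV
  have hle : Submodule.span ℂ (Set.range (X : Fin 3 → PS 3)) ≤ V := by
    refine Submodule.span_le.2 ?_
    rintro _ ⟨i, rfl⟩
    exact hV _ ⟨isHomogeneous_X ℂ i, X_ne_zero i⟩
  have h1 := Submodule.finrank_mono hle
  rw [finrank_span_eq_card (linearIndependent_X (Fin 3) ℂ), Fintype.card_fin] at h1
  exact lt_irrefl _ (h1.trans_lt h)

theorem linearIndependent_triple_of_notMem {V : Type*} [AddCommGroup V] [Module ℂ V]
    {x y z : V} (h : LinearIndependent ℂ ![y, z]) (hx : x ∉ Submodule.span ℂ {y, z}) :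
    LinearIndependent ℂ ![x, y, z] :=
  linearIndependent_finCons.2 ⟨h, by rwa [range_pair]⟩

theorem exists_linearIndependent_of_rk_le_two {A : Finset (PS 3)} (hA : ∀ β ∈ A, IsLinForm β)
    (h2 : rk A ≤ 2) {α z : PS 3} (hz : z ∈ A) (hαA : α ∉ Submodule.span ℂ (A : Set (PS 3)))
    (hpair : ∀ β ∈ A, ∀ β' ∈ A, β ≠ β' → LinearIndependent ℂ ![β, β']) :
    ∃ γ, IsLinForm γ ∧ LinearIndependent ℂ ![α, γ, z] ∧
      ∀ β ∈ A, β ∈ Submodule.span ℂ {γ, z} := by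
  have : Module.Finite ℂ (Submodule.span ℂ (A : Set (PS 3))) :=
    FiniteDimensional.span_finset ℂ A
  by_cases hγ : ∃ γ ∈ A, γ ≠ z
  · obtain ⟨γ, hγ, hne⟩ := hγ
    have hli := hpair γ hγ z hz hne
    have e : Submodule.span ℂ {γ, z} = Submodule.span ℂ (A : Set (PS 3)) := by
      refine Submodule.eq_of_le_of_finrank_le (Submodule.span_mono ?_) ?_
      · rintro _ (rfl | rfl) <;> assumption
      · have h := (rk_pair_iff γ z).2 hli
        rw [rk, Finset.coe_pair] at h
        exact h2.trans h.ge
    exact ⟨γ, hA γ hγ, linearIndependent_triple_of_notMem hli (e ▸ hαA),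
      fun β hβ => e ▸ Submodule.subset_span hβ⟩
  · push Not at hγ
    have hαz : LinearIndependent ℂ ![z, α] :=
      (LinearIndependent.pair_iff' (hA z hz).2).2 fun a ha =>
        hαA (ha ▸ Submodule.smul_mem _ a (Submodule.subset_span hz))
    have hli := LinearIndependent.pair_symm_iff.1 hαz
    have h := (rk_pair_iff α z).2 hli
    rw [rk, Finset.coe_pair] at h
    have : Module.Finite ℂ (Submodule.span ℂ ({α, z} : Set (PS 3))) :=
      FiniteDimensional.span_of_finite ℂ (Set.toFinite _)
    obtain ⟨γ, hγl, hγ'⟩ := exists_isLinForm_notMem (h.trans_lt (by norm_num))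
    refine ⟨γ, hγl, ?_, fun β hβ => hγ β hβ ▸ Submodule.subset_span (by simp)⟩
    have h3 := linearIndependent_triple_iff.1 (linearIndependent_triple_of_notMem hli hγ')
    refine linearIndependent_triple_iff.2 fun a b c e => ?_
    obtain ⟨hb, ha, hc⟩ := h3 b a c (by rw [← e]; abel)
    exact ⟨ha, hb, hc⟩

/-- The exponents of a nonempty arrangement of rank at most two. -/
theorem hasExp_of_rk_le_two {A : Finset (PS 3)} (hA : ∀ β ∈ A, IsLinForm β)
    (hne : A.Nonempty) (h2 : rk A ≤ 2) {α : PS 3} (hα : IsLinForm α)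
    (hαA : α ∉ Submodule.span ℂ (A : Set (PS 3)))
    (hpair : ∀ β ∈ A, ∀ β' ∈ A, β ≠ β' → LinearIndependent ℂ ![β, β']) :
    HasExp (A : Set (PS 3)) {1, 0, A.card - 1} := by
  classical
  obtain ⟨z, hz⟩ := hne
  have hzl := hA z hz
  obtain ⟨γ, hγ, hli, hspanA⟩ := exists_linearIndependent_of_rk_le_two hA h2 hz hαA hpair
  obtain ⟨g, hg⟩ := exists_dual hli ![1, 0, 0]
  obtain ⟨f, hf⟩ := exists_dual hli ![0, 1, 0]
  have hgα : g α = 1 := hg 0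
  have hgγ : g γ = 0 := hg 1
  have hgz : g z = 0 := hg 2
  have hfα : f α = 0 := hf 0
  have hfγ : f γ = 1 := hf 1
  have hfz : f z = 0 := hf 2
  have hgA : ∀ β ∈ A, g β = 0 := fun β hβ => by
    obtain ⟨a, b, rfl⟩ := Submodule.mem_span_pair.1 (hspanA β hβ)
    simp [hgγ, hgz]
  have hfA : ∀ β ∈ A.erase z, f β ≠ 0 := fun β hβ h0 => by
    obtain ⟨hβz, hβ⟩ := Finset.mem_erase.1 hβ
    obtain ⟨a, b, e⟩ := Submodule.mem_span_pair.1 (hspanA β hβ)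
    have ha : a = 0 := by simpa [← e, hfγ, hfz] using h0
    exact (LinearIndependent.pair_iff' hzl.2).1 (hpair z hz β hβ hβz.symm) b (by simp [← e, ha])
  set P := ∏ β ∈ A.erase z, β with hP
  have hP0 : P ≠ 0 :=
    Finset.prod_ne_zero_iff.2 fun β hβ => (hA β (Finset.mem_of_mem_erase hβ)).2
  set F : Der 3 := P • dirDer f with hF
  have hFA : F ∈ logDer (A : Set (PS 3)) := dirDer_prod_mem_logDer hA f hfz
  have hFdeg : IsHomogDer F (A.card - 1) := by
    rw [← Finset.card_erase_of_mem hz]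
    exact isHomogDer_prod_smul_dirDer (fun β hβ => hA β (Finset.mem_of_mem_erase hβ)) f
  have hGA : dirDer g ∈ logDer (A : Set (PS 3)) := mem_logDer.2 fun β hβ => by
    rw [dirDer_apply g (hA β hβ).1, hgA β hβ, C_0]
    exact dvd_zero _
  have hEA : euler 3 ∈ logDer (A : Set (PS 3)) := euler_mem_logDer hA
  have key := hasExp_of_fintype (A := (A : Set (PS 3))) ![euler 3, dirDer g, F]
    ![1, 0, A.card - 1] ?_ ?_ ?_
  · exact key
  · intro i
    fin_cases i
    exacts [isHomogDer_euler 3, isHomogDer_dirDer g, hFdeg]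
  · rw [range_triple]
    refine le_antisymm (Submodule.span_le.2 ?_) fun θ hθ => ?_
    · rintro _ (rfl | rfl | rfl) <;> assumption
    obtain ⟨h, hh⟩ := mem_logDer.1 hθ z hz
    obtain ⟨w, hw⟩ : ∃ w, w = θ γ - h * γ := ⟨_, rfl⟩
    have hdec : θ = h • euler 3 + (θ α - h * α) • dirDer g + w • dirDer f := by
      refine derivation_eq_of_triple hα hγ hzl hli ?_ ?_ ?_ <;>
        simp only [Derivation.add_apply, Derivation.smul_apply, dirDer_apply _ hα.1,
          dirDer_apply _ hγ.1, dirDer_apply _ hzl.1, euler_apply hα.1, euler_apply hγ.1,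
          euler_apply hzl.1, hgα, hgγ, hgz, hfα, hfγ, hfz, hh, hw, map_zero, map_one,
          smul_eq_mul] <;> ring
    have hPw : P ∣ w := by
      refine Finset.prod_dvd_of_isRelPrime (fun β hβ β' hβ' hne => ?_) fun β hβ => ?_
      · have h1 := Finset.mem_of_mem_erase hβ
        have h2 := Finset.mem_of_mem_erase hβ'
        exact (prime_of_isLinForm (hA β h1)).irreducible.isRelPrime_iff_not_dvd.2
          (not_dvd_of_linearIndependent (hA β h1) (hA β' h2) (hpair β h1 β' h2 hne))
      · have h1 := Finset.mem_of_mem_erase hβ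
        have e := congrArg (fun ξ : Der 3 => ξ β) hdec
        simp only [Derivation.add_apply, Derivation.smul_apply, dirDer_apply _ (hA β h1).1,
          euler_apply (hA β h1).1, hgA β h1, C_0, smul_eq_mul] at e
        obtain ⟨r, hr⟩ := mem_logDer.1 hθ β h1
        refine ⟨(r - h) * C (f β)⁻¹, ?_⟩
        have hc : (C (f β) * C (f β)⁻¹ : PS 3) = 1 := by
          rw [← C_mul, mul_inv_cancel₀ (hfA β hβ), C_1]
        linear_combination (-w) * hc - C (f β)⁻¹ * e + C (f β)⁻¹ * hr
    obtain ⟨v, rfl⟩ := hPw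
    rw [hdec]
    have hFv : (P * v) • dirDer f = v • F := by rw [hF, smul_smul, mul_comm]
    rw [hFv]
    exact add_mem (add_mem (Submodule.smul_mem _ _ (Submodule.subset_span (by simp)))
      (Submodule.smul_mem _ _ (Submodule.subset_span (by simp))))
      (Submodule.smul_mem _ _ (Submodule.subset_span (by simp)))
  · have hind : LinearIndependent (PS 3) ![euler 3, dirDer g, F] := by
      rw [Fintype.linearIndependent_iff]
      intro c hc
      have ez := congrArg (fun ξ : Der 3 => ξ z) hc
      have eα := congrArg (fun ξ : Der 3 => ξ α) hc
      have eγ := congrArg (fun ξ : Der 3 => ξ γ) hc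
      simp only [Fin.sum_univ_three, Matrix.cons_val, Derivation.add_apply,
        Derivation.smul_apply, Derivation.zero_apply, hF, dirDer_apply _ hα.1,
        dirDer_apply _ hγ.1, dirDer_apply _ hzl.1, euler_apply hα.1, euler_apply hγ.1,
        euler_apply hzl.1, hgα, hgγ, hgz, hfα, hfγ, hfz, map_zero, map_one, smul_eq_mul,
        mul_zero, mul_one, add_zero] at ez eα eγ
      have h0 : c 0 = 0 := (mul_eq_zero.1 ez).resolve_right hzl.2
      have h1 : c 1 = 0 := by simpa [h0] using eα
      have h2 : c 2 = 0 := by simpa [h0, hP0] using eγ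
      intro i
      fin_cases i <;> assumption
    exact fun i => hind.notMem_span_image (by simp)

theorem hasExp_congr {ℓ : ℕ} {A B : Set (PS ℓ)} (h : logDer A = logDer B) {M : Multiset ℕ} :
    HasExp A M ↔ HasExp B M := by
  simp only [HasExp, IsMinGen, h]

theorem rk_le_card {ℓ : ℕ} (B : Finset (PS ℓ)) : rk B ≤ B.card :=
  finrank_span_finset_le_card B

theorem rk_singleton {ℓ : ℕ} {β : PS ℓ} (hβ : β ≠ 0) : rk {β} = 1 := by
  rw [rk, Finset.coe_singleton, finrank_span_singleton hβ]

/-- `A'` contains exactly one defining form for every hyperplane of `A`. -/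
def IsTransversal {ℓ : ℕ} (A' A : Finset (PS ℓ)) : Prop :=
  A' ⊆ A ∧ (∀ β ∈ A', ∀ β' ∈ A', β ≠ β' → rk {β, β'} = 2) ∧
    ∀ β ∈ A, ∃ β' ∈ A', rk {β, β'} ≠ 2

theorem exists_isTransversal {ℓ : ℕ} (A : Finset (PS ℓ)) : ∃ A', IsTransversal A' A := by
  induction A using Finset.induction_on with
  | empty => exact ⟨∅, by simp [IsTransversal]⟩
  | insert a A ha ih =>
    obtain ⟨A', hsub, hpair, hcov⟩ := ih
    by_cases h : ∃ β' ∈ A', rk {a, β'} ≠ 2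
    · refine ⟨A', hsub.trans (Finset.subset_insert _ _), hpair, fun β hβ => ?_⟩
      rcases Finset.mem_insert.1 hβ with rfl | hβ
      exacts [h, hcov β hβ]
    · push Not at h
      refine ⟨insert a A', Finset.insert_subset_insert _ hsub, fun β hβ β' hβ' hne => ?_,
        fun β hβ => ?_⟩
      · rcases Finset.mem_insert.1 hβ with rfl | hβA <;>
          rcases Finset.mem_insert.1 hβ' with rfl | hβA'
        · exact absurd rfl hne
        · exact h _ hβA'
        · rw [Finset.pair_comm]
          exact h _ hβA
        · exact hpair _ hβA _ hβA' hne
      · rcases Finset.mem_insert.1 hβ with rfl | hβ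
        · refine ⟨β, Finset.mem_insert_self _ _, ?_⟩
          have := rk_le_card ({β} : Finset (PS ℓ))
          rw [Finset.card_singleton] at this
          rw [Finset.pair_eq_singleton]
          omega
        · obtain ⟨β', hβ', hr⟩ := hcov β hβ
          exact ⟨β', Finset.mem_insert_of_mem hβ', hr⟩

theorem IsTransversal.logDer_eq {ℓ : ℕ} {A' A : Finset (PS ℓ)} (h : IsTransversal A' A)
    (hA : ∀ β ∈ A, IsLinForm β) :
    logDer (A' : Set (PS ℓ)) = logDer (A : Set (PS ℓ)) := by
  ext θ
  rw [mem_logDer, mem_logDer]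
  refine ⟨fun hθ β hβ => ?_, fun hθ β hβ => hθ β (h.1 hβ)⟩
  obtain ⟨β', hβ', hr⟩ := h.2.2 β hβ
  rw [Ne, rk_pair_iff, LinearIndependent.pair_symm_iff,
    LinearIndependent.pair_iff' (hA β' (h.1 hβ')).2] at hr
  push Not at hr
  obtain ⟨c, rfl⟩ := hr
  rw [Derivation.map_smul, smul_eq_C_mul, smul_eq_C_mul]
  exact mul_dvd_mul_left _ (hθ β' hβ')

theorem IsTransversal.logDer_insert_eq {ℓ : ℕ} {A' A : Finset (PS ℓ)}
    (h : IsTransversal A' A) (hA : ∀ β ∈ A, IsLinForm β) (α : PS ℓ) :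
    logDer ((insert α A' : Finset (PS ℓ)) : Set (PS ℓ)) =
      logDer ((insert α A : Finset (PS ℓ)) : Set (PS ℓ)) := by
  ext θ
  rw [mem_logDer_insert, mem_logDer_insert, h.logDer_eq hA]

theorem IsTransversal.image {ℓ ℓ' : ℕ} {A₁' A₁ : Finset (PS ℓ)} {A₂ : Finset (PS ℓ')}
    (h : IsTransversal A₁' A₁) {e : PS ℓ → PS ℓ'} (he : Set.BijOn e A₁ A₂)
    (hrk : ∀ B ⊆ A₁, rk (B.image e) = rk B) : IsTransversal (A₁'.image e) A₂ := by
  have hpair : ∀ β ∈ A₁, ∀ β' ∈ A₁, rk {e β, e β'} = rk {β, β'} := fun β hβ β' hβ' => by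
    rw [← hrk {β, β'} (by simp [Finset.insert_subset_iff, hβ, hβ']), Finset.image_insert,
      Finset.image_singleton]
  refine ⟨Finset.image_subset_iff.2 fun β hβ => he.mapsTo (h.1 hβ), ?_, fun β hβ => ?_⟩
  · simp only [Finset.mem_image]
    rintro _ ⟨β, hβ, rfl⟩ _ ⟨β', hβ', rfl⟩ hne
    rw [hpair β (h.1 hβ) β' (h.1 hβ')]
    exact h.2.1 β hβ β' hβ' fun e' => hne (congrArg e e')
  · obtain ⟨γ, hγ, rfl⟩ := he.surjOn hβ
    obtain ⟨γ', hγ', hr⟩ := h.2.2 γ hγ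
    exact ⟨e γ', Finset.mem_image_of_mem e hγ', (hpair γ hγ γ' (h.1 hγ')).trans_ne hr⟩

theorem CombGeneric.mono {ℓ m : ℕ} {α : PS ℓ} {A' A : Finset (PS ℓ)} (h : CombGeneric α A m)
    (hA : A' ⊆ A) : CombGeneric α A' m :=
  fun B hB => h B (hB.trans hA)

theorem SameComb.insert {ℓ ℓ' m : ℕ} {A₁ : Finset (PS ℓ)} {A₂ : Finset (PS ℓ')}
    (h : SameComb A₁ A₂) {α₁ : PS ℓ} {α₂ : PS ℓ'} (hα₁ : α₁ ∉ A₁) (hα₂ : α₂ ∉ A₂)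
    (hgen₁ : CombGeneric α₁ A₁ m) (hgen₂ : CombGeneric α₂ A₂ m) :
    SameComb (insert α₁ A₁) (insert α₂ A₂) := by
  classical
  obtain ⟨e, he, hrk⟩ := h
  have heq : Set.EqOn e (Function.update e α₁ α₂) A₁ := fun β hβ =>
    (Function.update_of_ne (ne_of_mem_of_not_mem (Finset.mem_coe.1 hβ) hα₁) _ _).symm
  have himage : ∀ B ⊆ A₁, B.image (Function.update e α₁ α₂) = B.image e := fun B hB =>
    Finset.image_congr fun β hβ => (heq (hB hβ)).symm
  refine ⟨Function.update e α₁ α₂, ?_, fun B hB => ?_⟩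
  · have := (he.congr heq).insert (a := α₁) (by simpa using hα₂)
    simpa using this
  · by_cases hα : α₁ ∈ B
    · have hB' : B.erase α₁ ⊆ A₁ := Finset.subset_insert_iff.1 hB
      rw [← Finset.insert_erase hα, Finset.image_insert, himage _ hB', Function.update_self,
        hgen₁ _ hB', hgen₂ _ (Finset.image_subset_iff.2 fun β hβ => he.mapsTo (hB' hβ)),
        hrk _ hB']
    · have hB' : B ⊆ A₁ := (Finset.subset_insert_iff_of_notMem hα).1 hB
      rw [himage _ hB', hrk _ hB']

theorem CombGeneric.hasExp_of_rk_le_two {A : Finset (PS 3)} (hA : ∀ β ∈ A, IsLinForm β)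
    (hne : A.Nonempty) (h2 : rk A ≤ 2) {α : PS 3} (hα : IsLinForm α)
    (hgen : CombGeneric α A 3) (hpair : ∀ β ∈ A, ∀ β' ∈ A, β ≠ β' → rk {β, β'} = 2) :
    HasExp (A : Set (PS 3)) {1, 0, A.card - 1} := by
  refine _root_.hasExp_of_rk_le_two hA hne h2 hα (fun h => ?_) fun β hβ β' hβ' hne =>
    (rk_pair_iff β β').1 (hpair β hβ β' hβ' hne)
  have e := hgen A subset_rfl
  have e' : rk (insert α A) = rk A := by
    rw [rk, Finset.coe_insert, Submodule.span_insert_eq_span h, rk]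
  omega

theorem CombGeneric.exists_hasExp_insert {A : Finset (PS 3)} (hA : ∀ β ∈ A, IsLinForm β)
    (h3 : 3 ≤ rk A) {α : PS 3} (hα : IsLinForm α) (hgen : CombGeneric α A 3)
    (hpair : ∀ β ∈ A, ∀ β' ∈ A, β ≠ β' → rk {β, β'} = 2) :
    ∃ M : Multiset ℕ, HasExp (A : Set (PS 3)) (1 ::ₘ M) ∧
      HasExp ((insert α A : Finset (PS 3)) : Set (PS 3))
        ((A.card - 1) ::ₘ 1 ::ₘ M.map (· + 1)) := by
  refine _root_.exists_hasExp_insert hA hα h3 (fun β hβ => ?_) fun β hβ β' hβ' hne => ?_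
  · rw [← rk_pair_iff, hgen {β} (by simpa using hβ), rk_singleton (hA β hβ).2]
    rfl
  · rw [← rk_triple_iff, hgen {β, β'} (by simp [Finset.insert_subset_iff, hβ, hβ']),
      hpair β hβ β' hβ' hne]
    rfl

/-- adding combinatorially generic lines to a Ziegler pair of line
arrangements in `ℂ³` produces again a Ziegler pair: the new arrangements have the same
combinatorics and different exponent multisets. -/
theorem ziegler_pair_add_generic_line (A₁ A₂ : Finset (PS 3))
    (h₁ : ∀ β ∈ A₁, IsLinForm β) (h₂ : ∀ β ∈ A₂, IsLinForm β)
    (hcomb : SameComb A₁ A₂)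
    (hexp : ∀ M₁ M₂ : Multiset ℕ,
      HasExp (A₁ : Set (PS 3)) M₁ → HasExp (A₂ : Set (PS 3)) M₂ → M₁ ≠ M₂)
    (α₁ α₂ : PS 3) (hα₁lin : IsLinForm α₁) (hα₂lin : IsLinForm α₂)
    (hα₁ : α₁ ∉ A₁) (hα₂ : α₂ ∉ A₂)
    (hgen₁ : CombGeneric α₁ A₁ 3) (hgen₂ : CombGeneric α₂ A₂ 3) :
    SameComb (insert α₁ A₁) (insert α₂ A₂) ∧
    ∀ M₁ M₂ : Multiset ℕ,
      HasExp ((insert α₁ A₁ : Finset (PS 3)) : Set (PS 3)) M₁ →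
      HasExp ((insert α₂ A₂ : Finset (PS 3)) : Set (PS 3)) M₂ → M₁ ≠ M₂ := by
  refine ⟨hcomb.insert hα₁ hα₂ hgen₁ hgen₂, fun M₁ M₂ hM₁ hM₂ hM => ?_⟩
  obtain ⟨e, he, hrk⟩ := hcomb
  have hne : A₁.Nonempty := by
    rw [Finset.nonempty_iff_ne_empty]
    rintro rfl
    obtain ⟨M, hM⟩ := exists_hasExp h₁
    have h0 : (A₂ : Set (PS 3)) = (∅ : Finset (PS 3)) := by
      rw [← he.image_eq]
      simp
    exact hexp M M hM (h0 ▸ hM) rfl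
  obtain ⟨B₁, hB₁⟩ := exists_isTransversal A₁
  obtain ⟨B₂, hB₂e⟩ : ∃ B₂, B₂ = B₁.image e := ⟨_, rfl⟩
  have hB₂ : IsTransversal B₂ A₂ := hB₂e ▸ hB₁.image he hrk
  have hcard : B₂.card = B₁.card :=
    hB₂e ▸ Finset.card_image_of_injOn (he.injOn.mono hB₁.1)
  have hrkB : rk B₂ = rk B₁ := hB₂e ▸ hrk B₁ hB₁.1
  have hne₁ : B₁.Nonempty := by
    obtain ⟨β, hβ⟩ := hne
    obtain ⟨β', hβ', -⟩ := hB₁.2.2 β hβ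
    exact ⟨β', hβ'⟩
  have hne₂ : B₂.Nonempty := hB₂e ▸ hne₁.image e
  have hl₁ : ∀ β ∈ B₁, IsLinForm β := fun β hβ => h₁ β (hB₁.1 hβ)
  have hl₂ : ∀ β ∈ B₂, IsLinForm β := fun β hβ => h₂ β (hB₂.1 hβ)
  have hg₁ := hgen₁.mono hB₁.1
  have hg₂ := hgen₂.mono hB₂.1
  rcases Nat.lt_or_ge (rk B₁) 3 with hlt | hge
  · have e₁ := hg₁.hasExp_of_rk_le_two hl₁ hne₁ (by omega) hα₁lin hB₁.2.1
    have e₂ := hg₂.hasExp_of_rk_le_two hl₂ hne₂ (by omega) hα₂lin hB₂.2.1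
    rw [hcard] at e₂
    exact hexp _ _ ((hasExp_congr (hB₁.logDer_eq h₁)).1 e₁)
      ((hasExp_congr (hB₂.logDer_eq h₂)).1 e₂) rfl
  · obtain ⟨N₁, e₁, i₁⟩ := hg₁.exists_hasExp_insert hl₁ hge hα₁lin hB₁.2.1
    obtain ⟨N₂, e₂, i₂⟩ := hg₂.exists_hasExp_insert hl₂ (hrkB ▸ hge) hα₂lin hB₂.2.1
    have m₁ := hM₁.unique ((hasExp_congr (hB₁.logDer_insert_eq h₁ α₁)).1 i₁)
    have m₂ := hM₂.unique ((hasExp_congr (hB₂.logDer_insert_eq h₂ α₂)).1 i₂)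
    rw [m₁, m₂, hcard, Multiset.cons_inj_right, Multiset.cons_inj_right] at hM
    refine hexp _ _ ((hasExp_congr (hB₁.logDer_eq h₁)).1 e₁)
      ((hasExp_congr (hB₂.logDer_eq h₂)).1 e₂) ?_
    rw [Multiset.map_injective (add_left_injective 1) hM]

end
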